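/- Let G = (V,E) be a graph containing an induced path u–v–w on three vertices (so {u,v}, {v,w} ∈ E and {u,w} ∉ E) such that N_G(u) ∖ {u,v,w} = N_G(v) ∖ {u,v,w} and N_G(u) ∩ N_G(w) = {v}. Then G has a minimum-size cluster editing set containing the pair {v,w} (as a deletion); consequently, for every k ≥ 1, G has a cluster editing set of size at most k if and only if the graph obtained from G by deleting the edge {v,w} has a cluster editing set of size at most k − 1. -/

import Mathlib

open SimpleGraph

/-- The graph obtained from `G` by applying the edge modification set `S`. -/
def editEdges {V : Type*} (G : SimpleGraph V) (S : Set (Sym2 V)) : SimpleGraph V :=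
  SimpleGraph.fromEdgeSet (symmDiff G.edgeSet S)

/-- A cluster graph: a disjoint union of cliques, equivalently a `P₃`-free graph. -/
def IsClusterGraph {V : Type*} (G : SimpleGraph V) : Prop :=
  ∀ u v w : V, G.Adj u v → G.Adj v w → u ≠ w → G.Adj u w

/-- `S` is a cluster editing set for `G`. -/
def IsClusterEditingSet {V : Type*} (G : SimpleGraph V) (S : Finset (Sym2 V)) : Prop :=
  (∀ e ∈ S, ¬ e.IsDiag) ∧ IsClusterGraph (editEdges G ↑S)

/-- `τ(G)`: the minimum size of a cluster editing set for `G`. -/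
noncomputable def clusterEditNum {V : Type*} [Fintype V] [DecidableEq V]
    (G : SimpleGraph V) : ℕ :=
  sInf {n | ∃ S : Finset (Sym2 V), IsClusterEditingSet G S ∧ S.card = n}

open Finset in
/-- The number of ordered pairs on which two graphs disagree. -/
noncomputable def adjDist {V : Type*} [Fintype V] (G H : SimpleGraph V) : ℕ :=
  open Classical in ∑ x, ∑ y, if (G.Adj x y ↔ H.Adj x y) then 0 else 1

/-- The cluster graph whose cliques are the fibres of a labelling. -/
def fibreGraph {V ι : Type*} (f : V → ι) : SimpleGraph V where
  Adj x y := x ≠ y ∧ f x = f y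
  symm := ⟨fun _ _ h => ⟨h.1.symm, h.2.symm⟩⟩
  loopless := ⟨fun _ h => h.1 rfl⟩

theorem fibreGraph_adj {V ι : Type*} (f : V → ι) (x y : V) :
    (fibreGraph f).Adj x y ↔ x ≠ y ∧ f x = f y := Iff.rfl

theorem isClusterGraph_fibreGraph {V ι : Type*} (f : V → ι) :
    IsClusterGraph (fibreGraph f) :=
  fun _ _ _ h₁ h₂ hne => ⟨hne, h₁.2.trans h₂.2⟩

/-- A cluster graph is the fibre graph of its closed-neighbourhood labelling. -/
theorem IsClusterGraph.eq_fibreGraph {V : Type*} {H : SimpleGraph V} (hH : IsClusterGraph H) :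
    H = fibreGraph (fun x => some {y | x = y ∨ H.Adj x y}) := by
  ext x y
  simp only [fibreGraph_adj, Option.some.injEq, Set.ext_iff, Set.mem_ofPred_eq]
  constructor
  · intro h
    refine ⟨h.ne, fun z => ⟨?_, ?_⟩⟩
    · rintro (rfl | hz)
      · exact Or.inr h.symm
      · by_cases hyz : y = z
        · exact Or.inl hyz
        · exact Or.inr (hH y x z h.symm hz hyz)
    · rintro (rfl | hz)
      · exact Or.inr h
      · by_cases hxz : x = z
        · exact Or.inl hxz
        · exact Or.inr (hH x y z h hz hxz)
  · rintro ⟨hne, h⟩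
    exact ((h y).2 (Or.inl rfl)).resolve_left hne

theorem editEdges_adj {V : Type*} (G : SimpleGraph V) (S : Set (Sym2 V)) (x y : V) :
    (editEdges G S).Adj x y ↔ x ≠ y ∧ ¬(G.Adj x y ↔ s(x, y) ∈ S) := by
  simp only [editEdges, fromEdgeSet_adj, Set.mem_symmDiff, mem_edgeSet]
  tauto

open Finset in
/-- Twice the size of a set of edits counts the ordered pairs that it changes. -/
theorem two_mul_card_eq_adjDist {V : Type*} [Fintype V] (G : SimpleGraph V)
    (S : Finset (Sym2 V)) (hS : ∀ e ∈ S, ¬ e.IsDiag) :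
    2 * #S = adjDist G (editEdges G S) := by
  classical
  have hsum : ∑ x, (fromEdgeSet (S : Set (Sym2 V))).degree x = 2 * #S := by
    rw [sum_degrees_eq_twice_card_edges]
    congr 2
    ext e
    simp only [mem_edgeFinset, edgeSet_fromEdgeSet, Set.mem_sdiff, mem_coe]
    exact ⟨fun h => h.1, fun h => ⟨h, hS e h⟩⟩
  rw [← hsum]
  refine sum_congr rfl fun x _ => ?_
  rw [← card_neighborFinset_eq_degree, neighborFinset_eq_filter, card_filter]
  refine sum_congr rfl fun y _ => ?_
  have hd : s(x, y) ∈ S → x ≠ y := fun h => by simpa using hS _ h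
  have hG : G.Adj x y → x ≠ y := fun h => h.ne
  simp only [editEdges_adj, fromEdgeSet_adj, mem_coe]
  split_ifs <;> tauto

/-- Every labelling is realised by a cluster editing set. -/
theorem exists_isClusterEditingSet_fibreGraph {V ι : Type*} [Fintype V]
    (G : SimpleGraph V) (f : V → ι) :
    ∃ S : Finset (Sym2 V), IsClusterEditingSet G S ∧ editEdges G S = fibreGraph f := by
  classical
  have hS : editEdges G ((Finset.univ.filter fun e =>
      e ∈ symmDiff G.edgeSet (fibreGraph f).edgeSet : Finset (Sym2 V)) : Set (Sym2 V)) =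
      fibreGraph f := by
    ext x y
    have hG : G.Adj x y → x ≠ y := fun h => h.ne
    simp only [editEdges_adj, Finset.coe_filter, Finset.mem_univ, true_and, Set.mem_ofPred_eq,
      Set.mem_symmDiff, mem_edgeSet, fibreGraph_adj]
    tauto
  refine ⟨_, ⟨fun e he => ?_, by rw [hS]; exact isClusterGraph_fibreGraph f⟩, hS⟩
  rcases (Finset.mem_filter.1 he).2 with h | h
  · exact not_isDiag_of_mem_edgeSet _ h.1
  · exact not_isDiag_of_mem_edgeSet _ h.1

open Finset in
/-- A symmetric double sum vanishing on the diagonal, split along three distinct points. -/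
theorem sum_sum_eq_split_three {V : Type*} [Fintype V] [DecidableEq V] (c : V → V → ℕ)
    (hsymm : ∀ x y, c x y = c y x) (hdiag : ∀ x, c x x = 0) {u v w : V}
    (huv : u ≠ v) (hvw : v ≠ w) (huw : u ≠ w) :
    ∑ x, ∑ y, c x y = ∑ x ∈ univ \ {u, v, w}, ∑ y ∈ univ \ {u, v, w}, c x y +
      2 * ∑ y ∈ univ \ {u, v, w}, (c u y + c v y + c w y) +
      2 * (c u v + c u w + c v w) := by
  have key : ∀ g : V → ℕ, ∑ x, g x = ∑ x ∈ univ \ {u, v, w}, g x + (g u + g v + g w) := by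
    intro g
    rw [← sum_sdiff (subset_univ {u, v, w}), sum_insert (by simp [huv, huw]),
      sum_pair hvw, add_assoc]
  have hcol : ∀ a, ∑ x ∈ univ \ {u, v, w}, c x a = ∑ x ∈ univ \ {u, v, w}, c a x :=
    fun a => sum_congr rfl fun x _ => hsymm x a
  simp only [key, sum_add_distrib, hdiag, hcol, hsymm v u, hsymm w u, hsymm w v]
  ring

/-- A nonnegative combination inequality for `adjDist` follows from the inequality on the pairs
meeting `{u, v, w}`, for labellings agreeing outside of `{u, v, w}`. -/
theorem adjDist_fibreGraph_combination {V ι : Type*} [Fintype V] (G : SimpleGraph V)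
    {u v w : V} (huv : u ≠ v) (hvw : v ≠ w) (huw : u ≠ w) (f f₁ f₂ : V → ι) (m : ℕ)
    (c : (V → ι) → V → V → ℕ)
    (hc : ∀ g, c g = open Classical in
      fun x y => if (G.Adj x y ↔ (fibreGraph g).Adj x y) then 0 else 1)
    (h₁ : ∀ y, y ≠ u → y ≠ v → y ≠ w → f₁ y = f y)
    (h₂ : ∀ y, y ≠ u → y ≠ v → y ≠ w → f₂ y = f y)
    (hout : ∀ y, y ≠ u → y ≠ v → y ≠ w →
      m * (c f₁ u y + c f₁ v y + c f₁ w y) + (c f₂ u y + c f₂ v y + c f₂ w y) ≤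
        (m + 1) * (c f u y + c f v y + c f w y))
    (hin : m * (c f₁ u v + c f₁ u w + c f₁ v w) + (c f₂ u v + c f₂ u w + c f₂ v w) ≤
        (m + 1) * (c f u v + c f u w + c f v w)) :
    m * adjDist G (fibreGraph f₁) + adjDist G (fibreGraph f₂) ≤
      (m + 1) * adjDist G (fibreGraph f) := by
  classical
  have hsplit : ∀ g, adjDist G (fibreGraph g) = _ := fun g =>
    (show adjDist G (fibreGraph g) = ∑ x, ∑ y, c g x y by rw [hc]; rfl).trans
      (sum_sum_eq_split_three (c g) (fun x y => by simp only [hc, adj_comm])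
        (fun x => by simp [hc]) huv hvw huw)
  have hrest : ∀ g : V → ι, (∀ y, y ≠ u → y ≠ v → y ≠ w → g y = f y) →
      ∑ x ∈ Finset.univ \ {u, v, w}, ∑ y ∈ Finset.univ \ {u, v, w}, c g x y =
      ∑ x ∈ Finset.univ \ {u, v, w}, ∑ y ∈ Finset.univ \ {u, v, w}, c f x y := by
    intro g hg
    refine Finset.sum_congr rfl fun x hx => Finset.sum_congr rfl fun y hy => ?_
    simp only [Finset.mem_sdiff, Finset.mem_univ, true_and, Finset.mem_insert,
      Finset.mem_singleton, not_or] at hx hy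
    simp only [hc, fibreGraph_adj, hg x hx.1 hx.2.1 hx.2.2, hg y hy.1 hy.2.1 hy.2.2]
  have hsum := Finset.sum_le_sum (s := Finset.univ \ {u, v, w}) fun y hy => by
    simp only [Finset.mem_sdiff, Finset.mem_univ, true_and, Finset.mem_insert,
      Finset.mem_singleton, not_or] at hy
    exact hout y hy.1 hy.2.1 hy.2.2
  rw [Finset.sum_add_distrib, ← Finset.mul_sum, ← Finset.mul_sum] at hsum
  rw [hsplit f, hsplit f₁, hsplit f₂, hrest f₁ h₁, hrest f₂ h₂]
  nlinarith [hsum, hin]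

/-- If the fibre graph of `f` is closest to `G` among all fibre graphs and `none` is not a label,
then some labelling that is as good as `f` separates `v` from `w`. -/
theorem exists_separating_labelling {V α : Type*} [Fintype V] (G : SimpleGraph V) (u v w : V)
    (huv : G.Adj u v) (hvw : G.Adj v w) (huw : ¬ G.Adj u w) (hne : u ≠ w)
    (htwin : ∀ y, y ≠ u → y ≠ v → y ≠ w → (G.Adj u y ↔ G.Adj v y))
    (hdisj : ∀ y, y ≠ v → G.Adj u y → ¬ G.Adj w y)
    (f : V → Option α) (hf : ∀ x, f x ≠ none)
    (hmin : ∀ g : V → Option α, adjDist G (fibreGraph f) ≤ adjDist G (fibreGraph g)) :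
    ∃ g : V → Option α, adjDist G (fibreGraph g) ≤ adjDist G (fibreGraph f) ∧ g v ≠ g w := by
  classical
  by_cases hfvw : f v = f w
  swap
  · exact ⟨f, le_rfl, hfvw⟩
  have hnuv := huv.ne
  have hnvw := hvw.ne
  by_cases hfuv : f u = f v
  · have hcomb := adjDist_fibreGraph_combination G hnuv hnvw hne f (Function.update f w none)
      (Function.update (Function.update f u none) v none) 2 _ (fun _ => rfl)
      (fun y _ _ h => by simp [h]) (fun y h h' _ => by simp [h, h'])
      (fun y hyu hyv hyw => by
        have := htwin y hyu hyv hyw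
        have := hdisj y hyv
        have hfy : none ≠ f y := (hf y).symm
        have hfw : f w ≠ none := hf w
        simp only [fibreGraph_adj, Function.update_apply, hyu, hyv, hyw, hnuv, hnvw, hne,
          hnuv.symm, hnvw.symm, hne.symm, hyu.symm, hyv.symm, hyw.symm, hfuv, hfvw, hfy,
          if_true, if_false, ne_eq, not_false_eq_true, true_and]
        by_cases h1 : G.Adj u y <;> by_cases h2 : G.Adj v y <;> by_cases h3 : G.Adj w y <;>
          by_cases h4 : f w = f y <;> simp_all)
      (by
        have hfw : f w ≠ none := hf w
        simp [fibreGraph_adj, hnuv, hnvw, hne, hnvw.symm, hne.symm, hfuv, hfvw, huv, hvw, huw, hfw, hfw.symm])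
    by_cases hle : adjDist G (fibreGraph (Function.update f w none)) ≤ adjDist G (fibreGraph f)
    · exact ⟨_, hle, by simp [hnvw, hf]⟩
    · refine ⟨_, show adjDist G (fibreGraph
        (Function.update (Function.update f u none) v none)) ≤ _ by omega, ?_⟩
      simpa [hnvw.symm, hne.symm] using (hf w).symm
  · have hcomb := adjDist_fibreGraph_combination G hnuv hnvw hne f (Function.update f v (f u))
      (Function.update f u (f v)) 1 _ (fun _ => rfl)
      (fun y _ h _ => by simp [h]) (fun y h _ _ => by simp [h])
      (fun y hyu hyv hyw => by
        have := htwin y hyu hyv hyw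
        simp only [fibreGraph_adj, Function.update_apply, hyu, hyv, hnuv,
          hnuv.symm, hnvw.symm, hne.symm, hyu.symm, hyv.symm, hyw.symm, this,
          if_true, if_false, ne_eq, not_false_eq_true, true_and]
        omega)
      (by
        have hfuw : f u ≠ f w := hfvw ▸ hfuv
        simp [fibreGraph_adj, hnuv, hnvw, hne,
          hnuv.symm, hnvw.symm, hne.symm, hfvw, huv, hvw, huw, hfuw])
    have := hmin (Function.update f u (f v))
    refine ⟨_, show adjDist G (fibreGraph (Function.update f v (f u))) ≤ _ by omega, ?_⟩
    simpa [hnvw.symm, ← hfvw] using hfuv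

theorem clusterEditNum_le {V : Type*} [Fintype V] [DecidableEq V] {G : SimpleGraph V}
    {S : Finset (Sym2 V)} (hS : IsClusterEditingSet G S) : clusterEditNum G ≤ S.card :=
  Nat.sInf_le ⟨S, hS, rfl⟩

theorem exists_card_eq_clusterEditNum {V : Type*} [Fintype V] [DecidableEq V]
    (G : SimpleGraph V) :
    ∃ S : Finset (Sym2 V), IsClusterEditingSet G S ∧ S.card = clusterEditNum G := by
  obtain ⟨S, hS, -⟩ := exists_isClusterEditingSet_fibreGraph G (id : V → V)
  exact Nat.sInf_mem (s := {n | ∃ S : Finset (Sym2 V), IsClusterEditingSet G S ∧ S.card = n})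
    ⟨S.card, S, hS, rfl⟩

theorem editEdges_deleteEdges_singleton {V : Type*} (G : SimpleGraph V) {e : Sym2 V}
    (he : e ∈ G.edgeSet) (S : Set (Sym2 V)) :
    editEdges (G.deleteEdges {e}) S = editEdges G (symmDiff {e} S) := by
  have h : G.edgeSet \ {e} = symmDiff G.edgeSet {e} := by
    ext x
    simp only [Set.mem_sdiff, Set.mem_singleton_iff, Set.mem_symmDiff]
    constructor
    · exact Or.inl
    · rintro (h | ⟨rfl, h⟩)
      · exact h
      · exact absurd he h
  rw [editEdges, editEdges, edgeSet_deleteEdges, h, symmDiff_assoc]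

theorem isClusterEditingSet_deleteEdges_iff {V : Type*} [DecidableEq V] (G : SimpleGraph V)
    {e : Sym2 V} (he : e ∈ G.edgeSet) (S : Finset (Sym2 V)) :
    IsClusterEditingSet (G.deleteEdges {e}) S ↔ IsClusterEditingSet G (symmDiff {e} S) := by
  have hd : ¬ e.IsDiag := not_isDiag_of_mem_edgeSet _ he
  rw [IsClusterEditingSet, IsClusterEditingSet, editEdges_deleteEdges_singleton G he,
    Finset.coe_symmDiff, Finset.coe_singleton]
  refine and_congr_left fun _ => ⟨fun h x hx => ?_, fun h x hx => ?_⟩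
  · rcases Finset.mem_symmDiff.1 hx with ⟨h', -⟩ | ⟨h', -⟩
    · rwa [Finset.mem_singleton.1 h']
    · exact h x h'
  · by_cases hxe : x = e
    · rwa [hxe]
    · exact h x (Finset.mem_symmDiff.2 (Or.inr ⟨hx, by simpa using hxe⟩))

/-- correctness of Rule 5 for Cluster Editing. If `G` contains an
induced path `u–v–w` such that `u` and `v` have identical neighborhoods outside
`{u,v,w}` and `N(u) ∩ N(w) = {v}`, then `G` has a minimum-size cluster editing set
containing the deletion `{v,w}`; consequently, for every `k ≥ 1`, `G` has a cluster
editing set of size at most `k` iff the graph obtained by deleting the edge `{v,w}`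
has one of size at most `k - 1`. -/
theorem stmt12 {V : Type*} [Fintype V] [DecidableEq V]
    (G : SimpleGraph V) (u v w : V)
    (huv : G.Adj u v) (hvw : G.Adj v w) (huw : ¬ G.Adj u w) (hne : u ≠ w)
    (h1 : G.neighborSet u \ {u, v, w} = G.neighborSet v \ {u, v, w})
    (h2 : G.neighborSet u ∩ G.neighborSet w = {v}) :
    (∃ S : Finset (Sym2 V), IsClusterEditingSet G S ∧
      S.card = clusterEditNum G ∧ s(v, w) ∈ S) ∧
    (∀ k : ℕ, 1 ≤ k →
      ((∃ S : Finset (Sym2 V), IsClusterEditingSet G S ∧ S.card ≤ k) ↔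
        (∃ S : Finset (Sym2 V),
          IsClusterEditingSet (G.deleteEdges {s(v, w)}) S ∧ S.card ≤ k - 1))) := by
  have hmain : ∃ S : Finset (Sym2 V), IsClusterEditingSet G S ∧
      S.card = clusterEditNum G ∧ s(v, w) ∈ S := by
    obtain ⟨S, hS, hcard⟩ := exists_card_eq_clusterEditNum G
    have hdist := two_mul_card_eq_adjDist G S hS.1
    rw [hS.2.eq_fibreGraph] at hdist
    obtain ⟨g, hg, hgvw⟩ := exists_separating_labelling G u v w huv hvw huw hne
      (fun y hyu hyv hyw => by
        have := Set.ext_iff.1 h1 y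
        simpa [hyu, hyv, hyw] using this)
      (fun y hyv hu hw => hyv (by
        have := (Set.ext_iff.1 h2 y).1 ⟨hu, hw⟩
        simpa using this))
      _ (fun x => Option.some_ne_none _) (fun g => by
        obtain ⟨T, hT, hTg⟩ := exists_isClusterEditingSet_fibreGraph G g
        have := two_mul_card_eq_adjDist G T hT.1
        have := clusterEditNum_le hT
        rw [← hdist, ← hTg]
        omega)
    obtain ⟨T, hT, hTg⟩ := exists_isClusterEditingSet_fibreGraph G g
    have hTdist := two_mul_card_eq_adjDist G T hT.1
    have hTmin := clusterEditNum_le hT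
    rw [hTg] at hTdist
    refine ⟨T, hT, by omega, ?_⟩
    by_contra hmem
    have hadj : (editEdges G T).Adj v w :=
      (editEdges_adj G T v w).2 ⟨hvw.ne, fun h => hmem (h.1 hvw)⟩
    rw [hTg] at hadj
    exact hgvw hadj.2
  refine ⟨hmain, fun k hk => ⟨?_, ?_⟩⟩
  · rintro ⟨S, hS, hSk⟩
    obtain ⟨T, hT, hTcard, hmem⟩ := hmain
    have hmin := clusterEditNum_le hS
    refine ⟨symmDiff {s(v, w)} T, ?_, ?_⟩
    · rwa [isClusterEditingSet_deleteEdges_iff G hvw, symmDiff_symmDiff_cancel_left]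
    · rw [symmDiff_of_le (by simpa using hmem), Finset.card_sdiff_of_subset (by simpa using hmem),
        Finset.card_singleton]
      omega
  · rintro ⟨S, hS, hSk⟩
    refine ⟨_, (isClusterEditingSet_deleteEdges_iff G hvw S).1 hS, ?_⟩
    have hle : (symmDiff {s(v, w)} S).card ≤ ({s(v, w)} ∪ S : Finset (Sym2 V)).card :=
      Finset.card_le_card symmDiff_le_sup
    have hunion := Finset.card_union_le {s(v, w)} S
    rw [Finset.card_singleton] at hunion
    omega
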